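/- Let G be a dense, K_4^3 ∪ e-free 3-graph with λ(G) > √3/18, and let x be an optimum weight vector for G. If v is a vertex of G such that the induced subgraph G − {v} (obtained by deleting v and all edges containing v) is K_4^3-free, then x_v > 0.0848. -/

import Mathlib

open Finset

/-- An `r`-uniform hypergraph (r-graph) with vertices drawn from `ℕ`. -/
structure HyperGraph (r : ℕ) where
  verts : Finset ℕ
  edges : Finset (Finset ℕ)
  edges_sub : ∀ e ∈ edges, e ⊆ verts
  card_eq : ∀ e ∈ edges, e.card = r

/-- A 3-uniform hypergraph (3-graph). -/
abbrev ThreeGraph := HyperGraph 3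

/-- A feasible weight vector on `G`: nonnegative weights on the vertices summing to 1. -/
def HyperGraph.IsFeasible {r : ℕ} (G : HyperGraph r) (w : ℕ → ℝ) : Prop :=
  (∀ v ∈ G.verts, 0 ≤ w v) ∧ ∑ v ∈ G.verts, w v = 1

/-- The Lagrangian function `λ(G, w) = Σ_{e ∈ E(G)} Π_{v ∈ e} w v`. -/
noncomputable def HyperGraph.lagFun {r : ℕ} (G : HyperGraph r) (w : ℕ → ℝ) : ℝ :=
  ∑ e ∈ G.edges, ∏ v ∈ e, w v

/-- The Lagrangian `λ(G)`: the maximum of `λ(G, w)` over feasible weight vectors. -/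
noncomputable def HyperGraph.lag {r : ℕ} (G : HyperGraph r) : ℝ :=
  sSup {x : ℝ | ∃ w, G.IsFeasible w ∧ G.lagFun w = x}

/-- `G` contains a copy of `F`: an injection of the vertices of `F` into those of `G`
mapping every edge of `F` to an edge of `G`. -/
def HyperGraph.ContainsCopy {r : ℕ} (G F : HyperGraph r) : Prop :=
  ∃ f : ℕ → ℕ, Set.InjOn f ↑F.verts ∧ (∀ v ∈ F.verts, f v ∈ G.verts) ∧
    ∀ e ∈ F.edges, e.image f ∈ G.edges

/-- `G` is `F`-free. -/
def HyperGraph.Free {r : ℕ} (G F : HyperGraph r) : Prop := ¬ G.ContainsCopy F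

/-- `H` is a subgraph of `G`. -/
def HyperGraph.IsSubgraph {r : ℕ} (H G : HyperGraph r) : Prop :=
  H.verts ⊆ G.verts ∧ H.edges ⊆ G.edges

/-- `G` is dense: every proper subgraph has strictly smaller Lagrangian. -/
def HyperGraph.LagDense {r : ℕ} (G : HyperGraph r) : Prop :=
  ∀ H : HyperGraph r, H.IsSubgraph G → (H.verts ≠ G.verts ∨ H.edges ≠ G.edges) →
    H.lag < G.lag

/-- The Lagrangian density `π_λ(F) = sup { r! · λ(G) : G is F-free }`. -/
noncomputable def lagDensity {r : ℕ} (F : HyperGraph r) : ℝ :=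
  sSup {x : ℝ | ∃ G : HyperGraph r, G.Free F ∧ x = (Nat.factorial r : ℝ) * G.lag}

/-- An optimum weight vector for `G`. -/
def HyperGraph.IsOptimal {r : ℕ} (G : HyperGraph r) (w : ℕ → ℝ) : Prop :=
  G.IsFeasible w ∧ G.lagFun w = G.lag

/-- `K_4^3 ∪ e`: the disjoint union of the complete 3-graph on `{1,2,3,4}`
and the single edge `{5,6,7}`. -/
def K43e : ThreeGraph where
  verts := {1, 2, 3, 4, 5, 6, 7}
  edges := {{1, 2, 3}, {1, 2, 4}, {1, 3, 4}, {2, 3, 4}, {5, 6, 7}}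
  edges_sub := by decide
  card_eq := by decide

/-- `K_4^3`: the complete 3-graph on `{1, 2, 3, 4}`. -/
def K43 : ThreeGraph where
  verts := {1, 2, 3, 4}
  edges := Finset.powersetCard 3 ({1, 2, 3, 4} : Finset ℕ)
  edges_sub := by decide
  card_eq := by decide

/-- `G − {v}`: the subgraph of `G` induced by deleting the vertex `v` (and all edges
containing `v`). -/
def HyperGraph.deleteVert {r : ℕ} (G : HyperGraph r) (v : ℕ) : HyperGraph r where
  verts := G.verts.erase v
  edges := G.edges.filter (fun e => v ∉ e)
  edges_sub := by
    intro e he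
    rw [Finset.mem_filter] at he
    intro u hu
    rw [Finset.mem_erase]
    exact ⟨fun h => he.2 (h ▸ hu), G.edges_sub e he.1 hu⟩
  card_eq := by
    intro e he
    rw [Finset.mem_filter] at he
    exact G.card_eq e he.1


/-- First linear form of the certificate (root triple a non-edge). -/
def cl1 (p q r : Bool) : ℤ :=
  match p, q, r with
  | false, false, false => -48
  | true, false, false => 7
  | false, true, false => 7
  | false, false, true => 7
  | true, true, false => -37
  | true, false, true => -37
  | false, true, true => -37
  | true, true, true => 73

/-- Second linear form of the certificate (root triple a non-edge). -/
def cl2 (p q r : Bool) : ℤ :=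
  match p, q, r with
  | false, false, false => 37
  | true, false, false => 63
  | false, true, false => 63
  | false, false, true => 63
  | true, true, false => -40
  | true, false, true => -40
  | false, true, true => -40
  | true, true, true => -1

/-- Antisymmetric linear form of the certificate (root triple an edge). -/
def cm (p q r : Bool) : ℤ :=
  match p, q, r with
  | true, false, false => 78
  | false, true, false => -78
  | true, false, true => 56
  | false, true, true => -56
  | _, _, _ => 0

/-- The certificate for one choice of root triple and the two further vertices. -/
def cg (t p q r p' q' r' : Bool) : ℤ :=
  match t with
  | true => 19200 + cm p q r * cm p' q' r' + cm p r q * cm p' r' q' + cm q r p * cm q' r' p'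
  | false => 3 * (cl1 p q r * cl1 p' q' r' + cl2 p q r * cl2 p' q' r')

set_option maxRecDepth 100000 in
theorem cert_all : ∀ b012 b013 b014 b023 b024 b034 b123 b124 b134 b234 : Bool,
    (b012 && b013 && b023 && b123) = false →
    (b012 && b014 && b024 && b124) = false →
    (b013 && b014 && b034 && b134) = false →
    (b023 && b024 && b034 && b234) = false →
    (b123 && b124 && b134 && b234) = false →
    cg b012 b013 b023 b123 b014 b024 b124 +
    cg b013 b012 b023 b123 b014 b034 b134 +
    cg b014 b012 b024 b124 b013 b034 b134 +
    cg b023 b012 b013 b123 b024 b034 b234 +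
    cg b024 b012 b014 b124 b023 b034 b234 +
    cg b034 b013 b014 b134 b023 b024 b234 +
    cg b123 b012 b013 b023 b124 b134 b234 +
    cg b124 b012 b014 b024 b123 b134 b234 +
    cg b134 b013 b014 b034 b123 b124 b234 +
    cg b234 b023 b024 b034 b123 b124 b134 ≤ 110784 := by
  decide +kernel

section
variable {ι : Type*} [Fintype ι]

def tup (ι : Type*) : (ι × ι × ι × ι × ι) ≃ (Fin 5 → ι) where
  toFun t := ![t.1, t.2.1, t.2.2.1, t.2.2.2.1, t.2.2.2.2]
  invFun f := (f 0, f 1, f 2, f 3, f 4)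
  left_inv t := rfl
  right_inv f := by
    funext i; fin_cases i <;> rfl

theorem sum_tup (F : (Fin 5 → ι) → ℝ) :
    ∑ ω, F ω = ∑ a, ∑ b, ∑ c, ∑ d, ∑ e, F ![a, b, c, d, e] := by
  rw [← Equiv.sum_comp (tup ι)]
  simp only [Fintype.sum_prod_type]
  rfl

theorem perm_inv (x : ι → ℝ) (s : Fin 5 → Fin 5) (hs : Function.Bijective s)
    (g : (Fin 5 → ι) → ℝ) :
    ∑ ω : Fin 5 → ι, (∏ i, x (ω i)) * g (fun i => ω (s i)) =
    ∑ ω : Fin 5 → ι, (∏ i, x (ω i)) * g ω := by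
  rw [← Equiv.sum_comp (Equiv.arrowCongr (Equiv.ofBijective s hs).symm (Equiv.refl ι))
    (fun ω => (∏ i, x (ω i)) * g ω)]
  refine Finset.sum_congr rfl fun ω _ => ?_
  congr 1
  exact (Equiv.prod_comp (Equiv.ofBijective s hs) (fun i => x (ω i))).symm

/-- the certificate at a five-tuple -/
noncomputable def gg (h : ι → ι → ι → Bool) (ω : Fin 5 → ι) : ℝ :=
  ((cg (h (ω 0) (ω 1) (ω 2)) (h (ω 0) (ω 1) (ω 3)) (h (ω 0) (ω 2) (ω 3)) (h (ω 1) (ω 2) (ω 3))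
    (h (ω 0) (ω 1) (ω 4)) (h (ω 0) (ω 2) (ω 4)) (h (ω 1) (ω 2) (ω 4)) : ℤ) : ℝ)

theorem gg_point (h : ι → ι → ι → Bool) (h1 : ∀ a b c, h a b c = h b a c)
    (h2 : ∀ a b c, h a b c = h a c b)
    (hK : ∀ a b c d, (h a b c && h a b d && h a c d && h b c d) = false) (ω : Fin 5 → ι) :
    gg h (fun i => ω (![0, 1, 2, 3, 4] i)) + gg h (fun i => ω (![0, 1, 3, 2, 4] i)) +
    gg h (fun i => ω (![0, 1, 4, 2, 3] i)) + gg h (fun i => ω (![0, 2, 3, 1, 4] i)) +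
    gg h (fun i => ω (![0, 2, 4, 1, 3] i)) + gg h (fun i => ω (![0, 3, 4, 1, 2] i)) +
    gg h (fun i => ω (![1, 2, 3, 0, 4] i)) + gg h (fun i => ω (![1, 2, 4, 0, 3] i)) +
    gg h (fun i => ω (![1, 3, 4, 0, 2] i)) + gg h (fun i => ω (![2, 3, 4, 0, 1] i)) ≤ 110784 := by
  have r1 : ∀ a b c, h b c a = h a b c := fun a b c => by rw [h2 b c a, h1 b a c]
  have key := cert_all (h (ω 0) (ω 1) (ω 2)) (h (ω 0) (ω 1) (ω 3)) (h (ω 0) (ω 1) (ω 4))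
    (h (ω 0) (ω 2) (ω 3)) (h (ω 0) (ω 2) (ω 4)) (h (ω 0) (ω 3) (ω 4))
    (h (ω 1) (ω 2) (ω 3)) (h (ω 1) (ω 2) (ω 4)) (h (ω 1) (ω 3) (ω 4)) (h (ω 2) (ω 3) (ω 4))
    (hK _ _ _ _) (hK _ _ _ _) (hK _ _ _ _) (hK _ _ _ _) (hK _ _ _ _)
  have key' := (Int.cast_le (R := ℝ)).2 key
  push_cast at key'
  refine le_trans (le_of_eq ?_) key'
  simp only [gg]
  simp only [Matrix.cons_val]
  rw [h2 (ω 0) (ω 3) (ω 2), h2 (ω 1) (ω 3) (ω 2), h2 (ω 0) (ω 4) (ω 2), h2 (ω 1) (ω 4) (ω 2),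
    h2 (ω 0) (ω 4) (ω 3), h2 (ω 1) (ω 4) (ω 3), h2 (ω 0) (ω 2) (ω 1), h2 (ω 0) (ω 3) (ω 1),
    h2 (ω 0) (ω 4) (ω 1), h2 (ω 2) (ω 4) (ω 3), r1 (ω 1) (ω 2) (ω 3), r1 (ω 1) (ω 2) (ω 4),
    r1 (ω 1) (ω 3) (ω 4), r1 (ω 0) (ω 1) (ω 2), r1 (ω 0) (ω 1) (ω 3), r1 (ω 0) (ω 1) (ω 4),
    r1 (ω 0) (ω 2) (ω 3), r1 (ω 0) (ω 2) (ω 4), r1 (ω 0) (ω 3) (ω 4),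
    r1 (ω 2) (ω 3) (ω 4)]

theorem inner_bound (h : ι → ι → ι → Bool) (x : ι → ℝ) (hsum : ∑ i, x i = 1) (a b c : ι) :
    19200 * (if h a b c then (1 : ℝ) else 0) ≤ ∑ d, ∑ e, x d * x e * gg h ![a, b, c, d, e] := by
  have sq : ∀ u : ι → ℝ, 0 ≤ ∑ d, ∑ e, x d * x e * (u d * u e) := by
    intro u
    have : ∑ d, ∑ e, x d * x e * (u d * u e) = (∑ d, x d * u d) * (∑ d, x d * u d) := by
      rw [Finset.sum_mul_sum]
      exact Finset.sum_congr rfl fun d _ => Finset.sum_congr rfl fun e _ => by ring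
    rw [this]; exact mul_self_nonneg _
  have one : ∑ d, ∑ e, x d * x e = 1 := by
    rw [← Finset.sum_mul_sum, hsum]; norm_num
  cases ht : h a b c
  · have e1 := sq (fun d => (cl1 (h a b d) (h a c d) (h b c d) : ℝ))
    have e2 := sq (fun d => (cl2 (h a b d) (h a c d) (h b c d) : ℝ))
    have : ∑ d, ∑ e, x d * x e * gg h ![a, b, c, d, e] =
        3 * (∑ d, ∑ e, x d * x e * ((cl1 (h a b d) (h a c d) (h b c d) : ℝ) *
          (cl1 (h a b e) (h a c e) (h b c e) : ℝ))) +
        3 * (∑ d, ∑ e, x d * x e * ((cl2 (h a b d) (h a c d) (h b c d) : ℝ) *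
          (cl2 (h a b e) (h a c e) (h b c e) : ℝ))) := by
      simp only [Finset.mul_sum, ← Finset.sum_add_distrib]
      refine Finset.sum_congr rfl fun d _ => Finset.sum_congr rfl fun e _ => ?_
      simp only [gg, Matrix.cons_val, ht, cg]
      push_cast
      ring
    rw [this]
    simp only [Bool.false_eq_true, if_false]
    linarith
  · have e1 := sq (fun d => (cm (h a b d) (h a c d) (h b c d) : ℝ))
    have e2 := sq (fun d => (cm (h a b d) (h b c d) (h a c d) : ℝ))
    have e3 := sq (fun d => (cm (h a c d) (h b c d) (h a b d) : ℝ))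
    have : ∑ d, ∑ e, x d * x e * gg h ![a, b, c, d, e] =
        19200 * (∑ d, ∑ e, x d * x e) +
        (∑ d, ∑ e, x d * x e * ((cm (h a b d) (h a c d) (h b c d) : ℝ) *
          (cm (h a b e) (h a c e) (h b c e) : ℝ))) +
        (∑ d, ∑ e, x d * x e * ((cm (h a b d) (h b c d) (h a c d) : ℝ) *
          (cm (h a b e) (h b c e) (h a c e) : ℝ))) +
        (∑ d, ∑ e, x d * x e * ((cm (h a c d) (h b c d) (h a b d) : ℝ) *
          (cm (h a c e) (h b c e) (h a b e) : ℝ))) := by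
      simp only [Finset.mul_sum, ← Finset.sum_add_distrib]
      refine Finset.sum_congr rfl fun d _ => Finset.sum_congr rfl fun e _ => ?_
      simp only [gg, Matrix.cons_val, ht, cg]
      push_cast
      ring
    rw [this, one]
    simp only [if_true]
    linarith

/-- The density of a `K_4^3`-free weighted 3-graph is at most `0.577`. -/
theorem k4free_bound (h : ι → ι → ι → Bool) (h1 : ∀ a b c, h a b c = h b a c)
    (h2 : ∀ a b c, h a b c = h a c b)
    (hK : ∀ a b c d, (h a b c && h a b d && h a c d && h b c d) = false)
    (x : ι → ℝ) (hx : ∀ i, 0 ≤ x i) (hsum : ∑ i, x i = 1) :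
    ∑ a, ∑ b, ∑ c, x a * x b * x c * (if h a b c then (1 : ℝ) else 0) ≤ 0.577 := by
  have tot : ∑ ω : Fin 5 → ι, (∏ i, x (ω i)) = 1 := by
    rw [← Fintype.prod_sum (fun (_ : Fin 5) j => x j)]
    simp [hsum]
  have up : 10 * ∑ ω : Fin 5 → ι, (∏ i, x (ω i)) * gg h ω ≤ 110784 := by
    have hp := fun s hs => perm_inv x s hs (gg h)
    have : 10 * ∑ ω : Fin 5 → ι, (∏ i, x (ω i)) * gg h ω =
      ∑ ω : Fin 5 → ι, (∏ i, x (ω i)) *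
      (gg h (fun i => ω (![0, 1, 2, 3, 4] i)) + gg h (fun i => ω (![0, 1, 3, 2, 4] i)) +
      gg h (fun i => ω (![0, 1, 4, 2, 3] i)) + gg h (fun i => ω (![0, 2, 3, 1, 4] i)) +
      gg h (fun i => ω (![0, 2, 4, 1, 3] i)) + gg h (fun i => ω (![0, 3, 4, 1, 2] i)) +
      gg h (fun i => ω (![1, 2, 3, 0, 4] i)) + gg h (fun i => ω (![1, 2, 4, 0, 3] i)) +
      gg h (fun i => ω (![1, 3, 4, 0, 2] i)) + gg h (fun i => ω (![2, 3, 4, 0, 1] i))) := by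
      simp only [mul_add, Finset.sum_add_distrib]
      rw [hp ![0, 1, 2, 3, 4] (by decide), hp ![0, 1, 3, 2, 4] (by decide),
        hp ![0, 1, 4, 2, 3] (by decide), hp ![0, 2, 3, 1, 4] (by decide),
        hp ![0, 2, 4, 1, 3] (by decide), hp ![0, 3, 4, 1, 2] (by decide),
        hp ![1, 2, 3, 0, 4] (by decide), hp ![1, 2, 4, 0, 3] (by decide),
        hp ![1, 3, 4, 0, 2] (by decide), hp ![2, 3, 4, 0, 1] (by decide)]
      ring
    rw [this]
    calc _ ≤ ∑ ω : Fin 5 → ι, (∏ i, x (ω i)) * 110784 :=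
          Finset.sum_le_sum fun ω _ => mul_le_mul_of_nonneg_left (gg_point h h1 h2 hK ω)
            (Finset.prod_nonneg fun i _ => hx _)
      _ = 110784 := by rw [← Finset.sum_mul, tot, one_mul]
  have low : 19200 * ∑ a, ∑ b, ∑ c, x a * x b * x c * (if h a b c then (1 : ℝ) else 0) ≤
      ∑ ω : Fin 5 → ι, (∏ i, x (ω i)) * gg h ω := by
    rw [sum_tup]
    simp only [Finset.mul_sum]
    refine Finset.sum_le_sum fun a _ => Finset.sum_le_sum fun b _ => Finset.sum_le_sum fun c _ => ?_
    have e := mul_le_mul_of_nonneg_left (inner_bound h x hsum a b c)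
      (mul_nonneg (mul_nonneg (hx a) (hx b)) (hx c))
    calc _ = x a * x b * x c * (19200 * (if h a b c then (1 : ℝ) else 0)) := by ring
      _ ≤ _ := e
      _ = _ := by
        simp only [Finset.mul_sum]
        refine Finset.sum_congr rfl fun d _ => Finset.sum_congr rfl fun e _ => ?_
        simp only [Fin.prod_univ_five, Matrix.cons_val]
        ring
  norm_num at up low ⊢
  linarith
end

/-! ### Ordered sums -/

theorem two_sum (K : ℕ → ℕ → ℝ) (hs : ∀ a b, K a b = K b a) (hd : ∀ a, K a a = 0)
    (R : Finset ℕ) (q : ℕ) (hq : q ∉ R) :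
    ∑ a ∈ insert q R, ∑ b ∈ insert q R, K a b =
      ∑ a ∈ R, ∑ b ∈ R, K a b + 2 * ∑ z ∈ R, K q z := by
  simp only [Finset.sum_insert hq, Finset.sum_add_distrib, hd]
  have : ∑ z ∈ R, K z q = ∑ z ∈ R, K q z := Finset.sum_congr rfl fun z _ => hs _ _
  rw [this]; ring

theorem three_sum (F : ℕ → ℕ → ℕ → ℝ) (h1 : ∀ a b c, F a b c = F b a c)
    (h2 : ∀ a b c, F a b c = F a c b) (hd : ∀ a b, F a a b = 0)
    (R : Finset ℕ) (q : ℕ) (hq : q ∉ R) :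
    ∑ a ∈ insert q R, ∑ b ∈ insert q R, ∑ c ∈ insert q R, F a b c =
      ∑ a ∈ R, ∑ b ∈ R, ∑ c ∈ R, F a b c + 3 * ∑ z ∈ R, ∑ w ∈ R, F q z w := by
  have d2 : ∀ a b, F a b a = 0 := fun a b => by rw [h2, hd]
  have d3 : ∀ a b, F b a a = 0 := fun a b => by rw [h1, d2]
  simp only [Finset.sum_insert hq, Finset.sum_add_distrib, hd, d2, d3]
  have e1 : ∑ z ∈ R, ∑ w ∈ R, F z q w = ∑ z ∈ R, ∑ w ∈ R, F q z w :=
    Finset.sum_congr rfl fun z _ => Finset.sum_congr rfl fun w _ => h1 _ _ _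
  have e2 : ∑ z ∈ R, ∑ w ∈ R, F z w q = ∑ z ∈ R, ∑ w ∈ R, F q z w :=
    Finset.sum_congr rfl fun z _ => Finset.sum_congr rfl fun w _ => by rw [h2, h1]
  rw [e1, e2]; simp; ring

/-- The ordered edge term. -/
noncomputable def FF (E : Finset (Finset ℕ)) (x : ℕ → ℝ) (a b c : ℕ) : ℝ :=
  x a * x b * x c * (if ({a, b, c} : Finset ℕ) ∈ E then 1 else 0)

theorem FF_1 (E : Finset (Finset ℕ)) (x : ℕ → ℝ) (a b c : ℕ) : FF E x a b c = FF E x b a c := by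
  unfold FF
  rw [Finset.insert_comm a b]; ring

theorem FF_2 (E : Finset (Finset ℕ)) (x : ℕ → ℝ) (a b c : ℕ) : FF E x a b c = FF E x a c b := by
  unfold FF
  rw [Finset.pair_comm b c]; ring

theorem not_mem_rep (E : Finset (Finset ℕ)) (hE : ∀ e ∈ E, e.card = 3) (a b : ℕ) :
    ({a, a, b} : Finset ℕ) ∉ E := by
  intro h
  have := hE _ h
  rw [Finset.insert_idem] at this
  have h2 := Finset.card_le_two (a := a) (b := b)
  omega

theorem FF_d (E : Finset (Finset ℕ)) (hE : ∀ e ∈ E, e.card = 3) (x : ℕ → ℝ) (a b : ℕ) :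
    FF E x a a b = 0 := by
  unfold FF
  rw [if_neg (not_mem_rep E hE a b), mul_zero]

/-- the ordered sum counts every edge six times -/
theorem ordered_sum (E : Finset (Finset ℕ)) (hE : ∀ e ∈ E, e.card = 3) (V : Finset ℕ)
    (hV : ∀ e ∈ E, e ⊆ V) (x : ℕ → ℝ) :
    ∑ a ∈ V, ∑ b ∈ V, ∑ c ∈ V, FF E x a b c = 6 * ∑ e ∈ E, ∏ v ∈ e, x v := by
  have step : ∀ a b c, FF E x a b c = ∑ e ∈ E, FF {e} x a b c := by
    intro a b c
    unfold FF
    rw [← Finset.mul_sum]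
    congr 1
    simp only [Finset.mem_singleton]
    rw [Finset.sum_ite_eq]
  simp only [step]
  have comm : ∑ a ∈ V, ∑ b ∈ V, ∑ c ∈ V, ∑ e ∈ E, FF {e} x a b c =
      ∑ e ∈ E, ∑ a ∈ V, ∑ b ∈ V, ∑ c ∈ V, FF {e} x a b c := by
    rw [Finset.sum_comm (s := E)]
    refine Finset.sum_congr rfl fun a _ => ?_
    rw [Finset.sum_comm (s := E)]
    refine Finset.sum_congr rfl fun b _ => ?_
    rw [Finset.sum_comm (s := E)]
  rw [comm, Finset.mul_sum]
  refine Finset.sum_congr rfl fun e he => ?_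
  have hc : ∀ f ∈ ({e} : Finset (Finset ℕ)), f.card = 3 := by
    intro f hf; rw [Finset.mem_singleton] at hf; rw [hf]; exact hE e he
  have z : ∀ a b c, a ∉ e → FF {e} x a b c = 0 := by
    intro a b c ha
    unfold FF
    rw [if_neg, mul_zero]
    intro h
    rw [Finset.mem_singleton] at h
    exact ha (h ▸ Finset.mem_insert_self _ _)
  have z2 : ∀ a b c, b ∉ e → FF {e} x a b c = 0 := fun a b c hb => by rw [FF_1, z _ _ _ hb]
  have z3 : ∀ a b c, c ∉ e → FF {e} x a b c = 0 := fun a b c hb => by rw [FF_2, z2 _ _ _ hb]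
  have r : ∑ a ∈ V, ∑ b ∈ V, ∑ c ∈ V, FF {e} x a b c =
      ∑ a ∈ e, ∑ b ∈ e, ∑ c ∈ e, FF {e} x a b c := by
    rw [← Finset.sum_subset (hV e he)
      (fun a _ ha => Finset.sum_eq_zero fun b _ => Finset.sum_eq_zero fun c _ => z a b c ha)]
    refine Finset.sum_congr rfl fun a _ => ?_
    rw [← Finset.sum_subset (hV e he)
      (fun b _ hb => Finset.sum_eq_zero fun c _ => z2 a b c hb)]
    refine Finset.sum_congr rfl fun b _ => ?_
    rw [← Finset.sum_subset (hV e he) (fun c _ hc => z3 a b c hc)]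
  rw [r]
  obtain ⟨p, q, u, hpq, hpu, hqu, rfl⟩ := Finset.card_eq_three.1 (hE e he)
  have n1 : p ∉ ({q, u} : Finset ℕ) := by simp [hpq, hpu]
  have n2 : q ∉ ({u} : Finset ℕ) := by simp [hqu]
  rw [three_sum _ (FF_1 _ _) (FF_2 _ _) (FF_d _ hc x) _ _ n1,
    three_sum _ (FF_1 _ _) (FF_2 _ _) (FF_d _ hc x) _ _ n2,
    two_sum (fun z w => FF _ x p z w) (fun a b => FF_2 _ _ _ _ _)
      (fun a => by rw [FF_1, FF_2, FF_d _ hc x]) _ _ n2]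
  rw [Finset.prod_insert n1, Finset.prod_insert n2, Finset.prod_singleton]
  simp only [Finset.sum_singleton]
  rw [FF_d _ hc x, FF_2 _ _ q u u, FF_1 _ _ q u u, FF_2 _ _ u q u, FF_d _ hc x, FF_2 _ _ p u u,
    FF_1 _ _ p u u, FF_2 _ _ u p u, FF_d _ hc x]
  unfold FF
  simp
  ring

/-! ### Real inequalities -/

theorem poly1 (p q : ℝ) (hp0 : 0 ≤ p) (hq : 0 ≤ q) :
    p ^ 3 / 27 + p ^ 2 * q / 6 + p * q ^ 2 / 2 ≤ 0.093 * (p + q) ^ 3 := by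
  nlinarith [mul_nonneg hp0 (sq_nonneg (p - 0.67 * q)), mul_nonneg hq (sq_nonneg (p - 0.67 * q)),
    pow_nonneg hq 3, pow_nonneg hp0 3]

theorem poly2 (p q : ℝ) (hp0 : 0 ≤ p) (hq : 0 ≤ q) :
    p ^ 3 / 27 + p ^ 2 * q / 3 + p * q ^ 2 / 3 ≤ 0.093 * (p + q) ^ 3 := by
  nlinarith [mul_nonneg hp0 (sq_nonneg (p - q)), mul_nonneg hq (sq_nonneg (p - q)),
    pow_nonneg hq 3, pow_nonneg hp0 3]

theorem real_bound (b c d q m1 m2 m3 Lb Lc Ld : ℝ) (hb : 0 ≤ b) (hc : 0 ≤ c) (hd : 0 ≤ d)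
    (hq : 0 ≤ q) (hm1 : m1 ≤ q) (hm2 : m2 ≤ q) (hm3 : m3 ≤ q)
    (hLb : Lb ≤ q ^ 2) (hLc : Lc ≤ q ^ 2) (hLd : Ld ≤ q ^ 2)
    (h1 : 2 * q * m1 + Lb + Lc ≤ 3 * q ^ 2) (h2 : 2 * q * m2 + Lb + Ld ≤ 3 * q ^ 2)
    (h3 : 2 * q * m3 + Lc + Ld ≤ 3 * q ^ 2) :
    b * c * d + (b * c * m1 + b * d * m2 + c * d * m3) + (b * Lb + c * Lc + d * Ld) / 2 ≤
      0.093 * (b + c + d + q) ^ 3 := by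
  obtain ⟨p, hp⟩ : ∃ p, p = b + c + d := ⟨_, rfl⟩
  obtain ⟨e, he⟩ : ∃ e, e = b * c + b * d + c * d := ⟨_, rfl⟩
  have hp0 : 0 ≤ p := by rw [hp]; positivity
  have he2 : 3 * e ≤ p ^ 2 := by
    rw [he, hp]; nlinarith [sq_nonneg (b - c), sq_nonneg (b - d), sq_nonneg (c - d)]
  have he3 : 27 * (b * c * d) ≤ p ^ 3 := by
    rw [hp]
    nlinarith [mul_nonneg hb (sq_nonneg (c - d)), mul_nonneg hc (sq_nonneg (b - d)),
      mul_nonneg hd (sq_nonneg (b - c)), mul_nonneg hb (sq_nonneg (b - c)),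
      mul_nonneg hb (sq_nonneg (b - d)), mul_nonneg hc (sq_nonneg (b - c)),
      mul_nonneg hc (sq_nonneg (c - d)), mul_nonneg hd (sq_nonneg (b - d)),
      mul_nonneg hd (sq_nonneg (c - d))]
  have k1 := mul_le_mul_of_nonneg_left h1 (mul_nonneg hb hc)
  have k2 := mul_le_mul_of_nonneg_left h2 (mul_nonneg hb hd)
  have k3 := mul_le_mul_of_nonneg_left h3 (mul_nonneg hc hd)
  obtain ⟨X, hX⟩ : ∃ X, X = (b * c * m1 + b * d * m2 + c * d * m3) +
    (b * Lb + c * Lc + d * Ld) / 2 := ⟨_, rfl⟩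
  have hpq : b + c + d + q = p + q := by rw [hp]
  rw [hpq, add_assoc, ← hX]
  rcases le_total p q with h | h
  · have l1 := mul_le_mul_of_nonneg_left hLb (mul_nonneg hb (by linarith : 0 ≤ q - c - d))
    have l2 := mul_le_mul_of_nonneg_left hLc (mul_nonneg hc (by linarith : 0 ≤ q - b - d))
    have l3 := mul_le_mul_of_nonneg_left hLd (mul_nonneg hd (by linarith : 0 ≤ q - b - c))
    have key : q * X ≤ q * (e * q / 2 + p * q ^ 2 / 2) := by
      rw [hX, he, hp]; linarith
    have key2 : X ≤ p ^ 2 * q / 6 + p * q ^ 2 / 2 := by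
      rcases eq_or_lt_of_le hq with h0 | h0
      · have hb0 : b = 0 := by linarith
        have hc0 : c = 0 := by linarith
        have hd0 : d = 0 := by linarith
        rw [hX, ← h0, hb0, hc0, hd0]; norm_num
      · have := le_of_mul_le_mul_left key h0
        nlinarith
    linarith [poly1 p q hp0 hq]
  · have l1 := mul_le_mul_of_nonneg_left hLb (mul_nonneg hb hb)
    have l2 := mul_le_mul_of_nonneg_left hLc (mul_nonneg hc hc)
    have l3 := mul_le_mul_of_nonneg_left hLd (mul_nonneg hd hd)
    have n1 := mul_le_mul_of_nonneg_left hm1 (mul_nonneg (mul_nonneg hb hc) (sub_nonneg.2 h))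
    have n2 := mul_le_mul_of_nonneg_left hm2 (mul_nonneg (mul_nonneg hb hd) (sub_nonneg.2 h))
    have n3 := mul_le_mul_of_nonneg_left hm3 (mul_nonneg (mul_nonneg hc hd) (sub_nonneg.2 h))
    have key : p * X ≤ e * (q * (p - q / 2)) + p ^ 2 * q ^ 2 / 2 := by
      rw [hX, he]; rw [hp] at n1 n2 n3 ⊢; linarith
    have key1 : e * (q * (p - q / 2)) ≤ p ^ 2 / 3 * (q * (p - q / 2)) :=
      mul_le_mul_of_nonneg_right (by linarith) (mul_nonneg hq (by linarith))
    have key2 : X ≤ p ^ 2 * q / 3 + p * q ^ 2 / 3 := by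
      rcases eq_or_lt_of_le hp0 with h0 | h0
      · have hb0 : b = 0 := by linarith
        have hc0 : c = 0 := by linarith
        have hd0 : d = 0 := by linarith
        rw [hX, ← h0, hb0, hc0, hd0]; norm_num
      · refine le_of_mul_le_mul_left ?_ h0
        linarith [key, key1]
    linarith [poly2 p q hp0 hq]

theorem kkt_real (P Q a : ℝ) (hQ : 0 ≤ Q) 
    (h : ∀ t : ℝ, 0 ≤ t → t ≤ 1 →
      (1 - t) ^ 3 * P + 3 * ((1 - t) * a + t) * (1 - t) ^ 2 * Q ≤ P + 3 * a * Q) :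
    Q ≤ P + 3 * a * Q := by
  obtain ⟨Λ, hΛ⟩ : ∃ Λ, Λ = P + 3 * a * Q := ⟨_, rfl⟩
  rw [← hΛ]
  by_contra hlt
  push Not at hlt
  have h0 : 0 ≤ Λ := by have := h 1 (by norm_num) le_rfl; norm_num at this; linarith
  have hQ0 : 0 < Q := lt_of_le_of_lt h0 hlt
  obtain ⟨t, ht⟩ : ∃ t, t = (Q - Λ) / (4 * Q) := ⟨_, rfl⟩
  have t0 : 0 < t := by rw [ht]; apply div_pos <;> linarith
  have t1 : t ≤ 1 / 4 := by rw [ht, div_le_iff₀ (by linarith)]; linarith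
  have tq : 4 * Q * t = Q - Λ := by rw [ht]; field_simp
  have := h t t0.le (by linarith)
  have e : t * (3 * (1 - t) ^ 2 * Q) ≤ t * (Λ * (3 - 3 * t + t ^ 2)) := by
    rw [← hΛ] at this
    have hP : P = Λ - 3 * a * Q := by linarith
    rw [hP] at this
    nlinarith
  have e2 := le_of_mul_le_mul_left e t0
  nlinarith [mul_nonneg h0 t0.le, mul_nonneg hQ (sq_nonneg t), mul_nonneg hQ0.le t0.le]

theorem final_real (s Λ P a : ℝ) (hs : s ^ 2 = 3) (hs0 : 0 ≤ s) (hΛ : s / 3 < Λ) (ha0 : 0 ≤ a)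
    (ha : a ≤ 0.0848) (h1 : Λ ≤ P + 3 * a * Λ) (h2 : P ≤ 6 * (0.093 * (1 - a) ^ 3)) : False := by
  have s1 : 1.732 ≤ s := by nlinarith
  have l1 : 0.5773 ≤ Λ := by linarith
  have : 0.5773 * (1 - 3 * a) ≤ Λ * (1 - 3 * a) := mul_le_mul_of_nonneg_right l1 (by linarith)
  nlinarith [mul_nonneg ha0 ha0, mul_nonneg (mul_nonneg ha0 ha0) ha0]

/-! ### Combinatorial facts -/

theorem edge_ne {G : ThreeGraph} {a b c : ℕ} (h : ({a, b, c} : Finset ℕ) ∈ G.edges) :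
    a ≠ b ∧ a ≠ c ∧ b ≠ c := by
  have hc := G.card_eq _ h
  refine ⟨?_, ?_, ?_⟩
  · rintro rfl
    exact not_mem_rep _ G.card_eq _ _ h
  · rintro rfl
    rw [Finset.insert_comm, Finset.pair_eq_singleton] at hc
    have := Finset.card_le_two (a := b) (b := a)
    omega
  · rintro rfl
    rw [Finset.pair_eq_singleton] at hc
    have := Finset.card_le_two (a := a) (b := b)
    omega

theorem edge_mem {G : ThreeGraph} {a b c : ℕ} (h : ({a, b, c} : Finset ℕ) ∈ G.edges) :
    a ∈ G.verts ∧ b ∈ G.verts ∧ c ∈ G.verts := by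
  have := G.edges_sub _ h
  exact ⟨this (by simp), this (by simp), this (by simp)⟩

theorem no_K4_delete (G : ThreeGraph) (v : ℕ) (hdel : (G.deleteVert v).Free K43)
    (a b c d : ℕ) (ha : a ≠ v) (hb : b ≠ v) (hc : c ≠ v) (hd : d ≠ v)
    (h1 : ({a, b, c} : Finset ℕ) ∈ G.edges) (h2 : ({a, b, d} : Finset ℕ) ∈ G.edges)
    (h3 : ({a, c, d} : Finset ℕ) ∈ G.edges) (h4 : ({b, c, d} : Finset ℕ) ∈ G.edges) : False := by
  apply hdel
  obtain ⟨hab, hac, hbc⟩ := edge_ne h1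
  obtain ⟨_, had, hbd⟩ := edge_ne h2
  obtain ⟨_, _, hcd⟩ := edge_ne h3
  obtain ⟨va, vb, vc⟩ := edge_mem h1
  obtain ⟨_, _, vd⟩ := edge_mem h2
  have hE : K43.edges = {{1, 2, 3}, {1, 2, 4}, {1, 3, 4}, {2, 3, 4}} := by decide
  refine ⟨fun n => if n = 1 then a else if n = 2 then b else if n = 3 then c else d, ?_, ?_, ?_⟩
  · intro i hi j hj hij
    simp only [K43, Finset.coe_insert, Finset.coe_singleton, Set.mem_insert_iff,
      Set.mem_singleton_iff] at hi hj
    rcases hi with rfl | rfl | rfl | rfl <;> rcases hj with rfl | rfl | rfl | rfl <;>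
      simp_all
  · intro i hi
    simp only [K43, Finset.mem_insert, Finset.mem_singleton] at hi
    simp only [HyperGraph.deleteVert, Finset.mem_erase]
    rcases hi with rfl | rfl | rfl | rfl <;> simp_all
  · intro e he
    rw [hE] at he
    simp only [Finset.mem_insert, Finset.mem_singleton] at he
    simp only [HyperGraph.deleteVert, Finset.mem_filter]
    rcases he with rfl | rfl | rfl | rfl <;>
      simp [Finset.image_insert, h1, h2, h3, h4, ha.symm, hb.symm, hc.symm, hd.symm]

set_option maxHeartbeats 2000000 in
theorem K4_meets (G : ThreeGraph) (hfree : G.Free K43e) (a b c d z w u : ℕ)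
    (h1 : ({a, b, c} : Finset ℕ) ∈ G.edges) (h2 : ({a, b, d} : Finset ℕ) ∈ G.edges)
    (h3 : ({a, c, d} : Finset ℕ) ∈ G.edges) (h4 : ({b, c, d} : Finset ℕ) ∈ G.edges)
    (hz : z ≠ a ∧ z ≠ b ∧ z ≠ c ∧ z ≠ d) (hw : w ≠ a ∧ w ≠ b ∧ w ≠ c ∧ w ≠ d)
    (hu : u ≠ a ∧ u ≠ b ∧ u ≠ c ∧ u ≠ d)
    (h5 : ({z, w, u} : Finset ℕ) ∈ G.edges) : False := by
  apply hfree
  obtain ⟨hab, hac, hbc⟩ := edge_ne h1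
  obtain ⟨_, had, hbd⟩ := edge_ne h2
  obtain ⟨_, _, hcd⟩ := edge_ne h3
  obtain ⟨hzw, hzu, hwu⟩ := edge_ne h5
  obtain ⟨va, vb, vc⟩ := edge_mem h1
  obtain ⟨_, _, vd⟩ := edge_mem h2
  obtain ⟨vz, vw, vu⟩ := edge_mem h5
  obtain ⟨z1, z2, z3, z4⟩ := hz
  obtain ⟨w1, w2, w3, w4⟩ := hw
  obtain ⟨u1, u2, u3, u4⟩ := hu
  refine ⟨fun n => if n = 1 then a else if n = 2 then b else if n = 3 then c else
    if n = 4 then d else if n = 5 then z else if n = 6 then w else u, ?_, ?_, ?_⟩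
  · intro i hi j hj hij
    simp only [K43e, Finset.coe_insert, Finset.coe_singleton, Set.mem_insert_iff,
      Set.mem_singleton_iff] at hi hj
    rcases hi with rfl | rfl | rfl | rfl | rfl | rfl | rfl <;>
      rcases hj with rfl | rfl | rfl | rfl | rfl | rfl | rfl <;>
      first
      | exact Eq.refl (_ : ℕ)
      | (exfalso
         clear h1 h2 h3 h4 h5 va vb vc vd vz vw vu hfree
         norm_num at hij
         first
         | contradiction
         | exact absurd hij.symm (by assumption))
  · intro i hi
    simp only [K43e, Finset.mem_insert, Finset.mem_singleton] at hi
    rcases hi with rfl | rfl | rfl | rfl | rfl | rfl | rfl <;> simpa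
  · intro e he
    simp only [K43e, Finset.mem_insert, Finset.mem_singleton] at he
    rcases he with rfl | rfl | rfl | rfl | rfl <;>
      simp [Finset.image_insert, h1, h2, h3, h4, h5]

/-! ### The two cases -/

theorem case_free (G : ThreeGraph) (x : ℕ → ℝ) (hx : G.IsFeasible x)
    (hK : ∀ a b c d : ℕ, ({a, b, c} : Finset ℕ) ∈ G.edges → ({a, b, d} : Finset ℕ) ∈ G.edges →
      ({a, c, d} : Finset ℕ) ∈ G.edges → ({b, c, d} : Finset ℕ) ∈ G.edges → False) :
    6 * G.lagFun x ≤ 0.577 := by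
  have key := k4free_bound (ι := G.verts)
    (fun a b c => decide (({(a : ℕ), (b : ℕ), (c : ℕ)} : Finset ℕ) ∈ G.edges))
    (fun a b c => by simp only [Finset.insert_comm (a : ℕ) b])
    (fun a b c => by simp only [Finset.pair_comm (b : ℕ) c])
    (fun a b c d => by
      rw [Bool.eq_false_iff]
      intro h
      simp only [Bool.and_eq_true, decide_eq_true_eq] at h
      exact hK _ _ _ _ h.1.1.1 h.1.1.2 h.1.2 h.2)
    (fun i => x i) (fun i => hx.1 i i.2)
    (by rw [Finset.sum_coe_sort G.verts x]; exact hx.2)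
  have o := ordered_sum G.edges G.card_eq G.verts G.edges_sub x
  unfold HyperGraph.lagFun
  rw [← o]
  refine le_trans (le_of_eq ?_) key
  simp only [FF, decide_eq_true_eq]
  rw [← Finset.sum_coe_sort G.verts]
  refine Finset.sum_congr rfl fun a _ => ?_
  rw [← Finset.sum_coe_sort G.verts]
  refine Finset.sum_congr rfl fun b _ => ?_
  rw [← Finset.sum_coe_sort G.verts]

/-- ordered link weight -/
theorem split_vertex (G : ThreeGraph) (x : ℕ → ℝ) (v : ℕ) (hv : v ∈ G.verts) :
    6 * G.lagFun x = ∑ a ∈ G.verts.erase v, ∑ b ∈ G.verts.erase v, ∑ c ∈ G.verts.erase v,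
      FF G.edges x a b c + 3 * ∑ z ∈ G.verts.erase v, ∑ w ∈ G.verts.erase v,
      FF G.edges x v z w := by
  unfold HyperGraph.lagFun
  rw [← ordered_sum G.edges G.card_eq G.verts G.edges_sub x]
  rw [← three_sum _ (FF_1 _ _) (FF_2 _ _) (FF_d _ G.card_eq x) _ _ (Finset.notMem_erase v _),
    Finset.insert_erase hv]

theorem FF_nonneg (E : Finset (Finset ℕ)) (x : ℕ → ℝ) (a b c : ℕ) (ha : 0 ≤ x a) (hb : 0 ≤ x b)
    (hc : 0 ≤ x c) : 0 ≤ FF E x a b c := by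
  unfold FF
  split_ifs <;> positivity

theorem lagFun_le_lag (G : ThreeGraph) (hpos : 0 < G.lag) (y : ℕ → ℝ) (hy : G.IsFeasible y) :
    G.lagFun y ≤ G.lag := by
  unfold HyperGraph.lag at hpos ⊢
  refine le_csSup ?_ ⟨y, hy, rfl⟩
  by_contra hb
  rw [Real.sSup_of_not_bddAbove hb] at hpos
  exact lt_irrefl _ hpos

theorem kkt (G : ThreeGraph) (hpos : 0 < G.lag) (x : ℕ → ℝ) (hx : G.IsOptimal x) (v : ℕ)
    (hv : v ∈ G.verts) :
    6 * G.lagFun x ≤ ∑ a ∈ G.verts.erase v, ∑ b ∈ G.verts.erase v, ∑ c ∈ G.verts.erase v,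
      FF G.edges x a b c + 3 * x v * (6 * G.lagFun x) := by
  obtain ⟨P, hP⟩ : ∃ P, P = ∑ a ∈ G.verts.erase v, ∑ b ∈ G.verts.erase v,
    ∑ c ∈ G.verts.erase v, FF G.edges x a b c := ⟨_, rfl⟩
  obtain ⟨Q, hQ⟩ : ∃ Q, Q = ∑ z ∈ G.verts.erase v, ∑ w ∈ G.verts.erase v,
    x z * x w * (if ({v, z, w} : Finset ℕ) ∈ G.edges then (1 : ℝ) else 0) := ⟨_, rfl⟩
  have nn : ∀ z ∈ G.verts, 0 ≤ x z := hx.1.1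
  have hQ0 : 0 ≤ Q := by
    rw [hQ]
    refine Finset.sum_nonneg fun z hz => Finset.sum_nonneg fun w hw => ?_
    have h1 := nn z (Finset.mem_of_mem_erase hz)
    have h2 := nn w (Finset.mem_of_mem_erase hw)
    split_ifs <;> positivity
  have hl : 6 * G.lagFun x = P + 3 * x v * Q := by
    have hs : ∑ z ∈ G.verts.erase v, ∑ w ∈ G.verts.erase v, FF G.edges x v z w = x v * Q := by
      rw [hQ, Finset.mul_sum]
      refine Finset.sum_congr rfl fun z _ => ?_
      rw [Finset.mul_sum]
      refine Finset.sum_congr rfl fun w _ => ?_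
      unfold FF; ring
    rw [split_vertex G x v hv, ← hP, hs, mul_assoc]
  have hk : Q ≤ P + 3 * x v * Q := by
    refine kkt_real P Q (x v) hQ0 fun t t0 t1 => ?_
    obtain ⟨y, hy⟩ : ∃ y : ℕ → ℝ, y = fun n => (1 - t) * x n + if n = v then t else 0 := ⟨_, rfl⟩
    have yf : G.IsFeasible y := by
      constructor
      · intro n hn
        rw [hy]
        have := mul_nonneg (sub_nonneg.2 t1) (nn n hn)
        dsimp only
        split_ifs <;> linarith
      · rw [hy, Finset.sum_add_distrib, ← Finset.mul_sum, hx.1.2, Finset.sum_ite_eq' G.verts v,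
          if_pos hv]
        ring
    have yv : y v = (1 - t) * x v + t := by rw [hy]; simp
    have yn : ∀ n ∈ G.verts.erase v, y n = (1 - t) * x n := by
      intro n hn
      rw [hy]; simp [Finset.ne_of_mem_erase hn]
    have le := lagFun_le_lag G hpos y yf
    rw [← hx.2] at le
    have e : 6 * G.lagFun y =
        (1 - t) ^ 3 * P + 3 * ((1 - t) * x v + t) * (1 - t) ^ 2 * Q := by
      rw [split_vertex G y v hv, hP, hQ]
      simp only [Finset.mul_sum]
      congr 1
      · refine Finset.sum_congr rfl fun a ha => Finset.sum_congr rfl fun b hb =>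
          Finset.sum_congr rfl fun c hc => ?_
        unfold FF
        rw [yn a ha, yn b hb, yn c hc]; ring
      · refine Finset.sum_congr rfl fun a ha => Finset.sum_congr rfl fun b hb => ?_
        unfold FF
        rw [yn a ha, yn b hb, yv]; ring
    linarith
  rw [← hP]
  have := mul_le_mul_of_nonneg_left hk (nn v hv)
  rw [hl]
  linarith

theorem pair_constraint (R : Finset ℕ) (x : ℕ → ℝ) (hx : ∀ z ∈ R, 0 ≤ x z)
    (f g : ℕ → ℝ) (k l : ℕ → ℕ → ℝ)
    (h : ∀ z ∈ R, ∀ w ∈ R, g z + g w + k z w + l z w ≤ 3) (hf : ∀ z, f z = x z * g z) :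
    2 * (∑ z ∈ R, x z) * (∑ z ∈ R, f z) + ∑ z ∈ R, ∑ w ∈ R, x z * x w * k z w +
      ∑ z ∈ R, ∑ w ∈ R, x z * x w * l z w ≤ 3 * (∑ z ∈ R, x z) ^ 2 := by
  have e1 : 2 * (∑ z ∈ R, x z) * (∑ z ∈ R, f z) =
      ∑ z ∈ R, ∑ w ∈ R, x z * x w * g z + ∑ z ∈ R, ∑ w ∈ R, x z * x w * g w := by
    have a1 : (∑ z ∈ R, x z) * (∑ z ∈ R, f z) = ∑ z ∈ R, ∑ w ∈ R, x z * x w * g w := by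
      rw [Finset.sum_mul_sum]
      refine Finset.sum_congr rfl fun z _ => Finset.sum_congr rfl fun w _ => ?_
      rw [hf]; ring
    have a2 : (∑ z ∈ R, f z) * (∑ z ∈ R, x z) = ∑ z ∈ R, ∑ w ∈ R, x z * x w * g z := by
      rw [Finset.sum_mul_sum]
      refine Finset.sum_congr rfl fun z _ => Finset.sum_congr rfl fun w _ => ?_
      rw [hf]; ring
    rw [← a1, ← a2]; ring
  have e2 : 3 * (∑ z ∈ R, x z) ^ 2 = ∑ z ∈ R, ∑ w ∈ R, x z * x w * 3 := by
    rw [sq, Finset.sum_mul_sum, Finset.mul_sum]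
    refine Finset.sum_congr rfl fun z _ => ?_
    rw [Finset.mul_sum]
    exact Finset.sum_congr rfl fun w _ => by ring
  rw [e1, e2]
  simp only [← Finset.sum_add_distrib]
  refine Finset.sum_le_sum fun z hz => Finset.sum_le_sum fun w hw => ?_
  have := mul_le_mul_of_nonneg_left (h z hz w hw) (mul_nonneg (hx z hz) (hx w hw))
  linarith

theorem case_K4 (E : Finset (Finset ℕ)) (hE : ∀ e ∈ E, e.card = 3) (x : ℕ → ℝ)
    (R : Finset ℕ) (b c d : ℕ) (hb : b ∉ insert c (insert d R)) (hc : c ∉ insert d R) (hd : d ∉ R)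
    (hx : ∀ z ∈ insert b (insert c (insert d R)), 0 ≤ x z)
    (hR : ∀ z ∈ R, ∀ w ∈ R, ∀ u ∈ R, ({z, w, u} : Finset ℕ) ∉ E)
    (hK : ∀ i ∈ insert b (insert c (insert d R)), ∀ j ∈ insert b (insert c (insert d R)),
      ∀ z ∈ R, ∀ w ∈ R, ({i, j, z} : Finset ℕ) ∈ E → ({i, j, w} : Finset ℕ) ∈ E →
      ({i, z, w} : Finset ℕ) ∈ E → ({j, z, w} : Finset ℕ) ∈ E → False) :
    ∑ i ∈ insert b (insert c (insert d R)), ∑ j ∈ insert b (insert c (insert d R)),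
      ∑ k ∈ insert b (insert c (insert d R)), FF E x i j k ≤
      6 * (0.093 * (∑ i ∈ insert b (insert c (insert d R)), x i) ^ 3) := by
  have xb : 0 ≤ x b := hx b (by simp)
  have xc : 0 ≤ x c := hx c (by simp)
  have xd : 0 ≤ x d := hx d (by simp)
  have xR : ∀ z ∈ R, 0 ≤ x z := fun z hz => hx z (by simp [hz])
  obtain ⟨I, hI⟩ : ∃ I : ℕ → ℕ → ℕ → ℝ,
    I = fun a b c => if ({a, b, c} : Finset ℕ) ∈ E then 1 else 0 := ⟨_, rfl⟩
  have I0 : ∀ a b c, 0 ≤ I a b c := by intro a b c; rw [hI]; dsimp only; split_ifs <;> norm_num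
  have I1 : ∀ a b c, I a b c ≤ 1 := by intro a b c; rw [hI]; dsimp only; split_ifs <;> norm_num
  have FI : ∀ a b c, FF E x a b c = x a * x b * x c * I a b c := by intro a b c; rw [hI]; rfl
  obtain ⟨q, hq⟩ : ∃ q, q = ∑ z ∈ R, x z := ⟨_, rfl⟩
  have q0 : 0 ≤ q := by rw [hq]; exact Finset.sum_nonneg xR
  obtain ⟨m, hm⟩ : ∃ m : ℕ → ℕ → ℝ, m = fun i j => ∑ z ∈ R, x z * I i j z := ⟨_, rfl⟩
  obtain ⟨L, hL⟩ : ∃ L : ℕ → ℝ, L = fun i => ∑ z ∈ R, ∑ w ∈ R, x z * x w * I i z w := ⟨_, rfl⟩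
  have m_le : ∀ i j, m i j ≤ q := by
    intro i j
    rw [hm, hq]
    exact Finset.sum_le_sum fun z hz => mul_le_of_le_one_right (xR z hz) (I1 _ _ _)
  have L_le : ∀ i, L i ≤ q ^ 2 := by
    intro i
    rw [hL, hq, sq, Finset.sum_mul_sum]
    exact Finset.sum_le_sum fun z hz => Finset.sum_le_sum fun w hw =>
      mul_le_of_le_one_right (mul_nonneg (xR z hz) (xR w hw)) (I1 _ _ _)
  have pc : ∀ i ∈ insert b (insert c (insert d R)), ∀ j ∈ insert b (insert c (insert d R)),
      2 * q * m i j + L i + L j ≤ 3 * q ^ 2 := by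
    intro i hi j hj
    rw [hm, hL, hq]
    refine pair_constraint R x xR (fun z => x z * I i j z) (fun z => I i j z)
      (fun z w => I i z w) (fun z w => I j z w) ?_ (fun z => rfl)
    intro z hz w hw
    have := hK i hi j hj z hz w hw
    rw [hI]
    dsimp only
    by_cases a1 : ({i, j, z} : Finset ℕ) ∈ E <;> by_cases a2 : ({i, j, w} : Finset ℕ) ∈ E <;>
      by_cases a3 : ({i, z, w} : Finset ℕ) ∈ E <;> by_cases a4 : ({j, z, w} : Finset ℕ) ∈ E <;>
      simp only [a1, a2, a3, a4, if_true, if_false] <;> first | exact (this a1 a2 a3 a4).elim | norm_num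
  have rb := real_bound (x b) (x c) (x d) q (m b c) (m b d) (m c d) (L b) (L c) (L d)
    xb xc xd q0 (m_le _ _) (m_le _ _) (m_le _ _) (L_le _) (L_le _) (L_le _)
    (pc b (by simp) c (by simp)) (pc b (by simp) d (by simp)) (pc c (by simp) d (by simp))
  have sumx : ∑ i ∈ insert b (insert c (insert d R)), x i = x b + x c + x d + q := by
    rw [Finset.sum_insert hb, Finset.sum_insert hc, Finset.sum_insert hd, hq]; ring
  have dd : ∀ p a, FF E x p a a = 0 := fun p a => by rw [FF_1, FF_2, FF_d E hE]
  have t2 := fun p => two_sum (fun z w => FF E x p z w) (fun a b => FF_2 _ _ _ _ _) (dd p)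
  have RRR : ∑ z ∈ R, ∑ w ∈ R, ∑ u ∈ R, FF E x z w u = 0 := by
    refine Finset.sum_eq_zero fun z hz => Finset.sum_eq_zero fun w hw =>
      Finset.sum_eq_zero fun u hu => ?_
    unfold FF
    rw [if_neg (hR z hz w hw u hu), mul_zero]
  have eL : ∀ p, ∑ z ∈ R, ∑ w ∈ R, FF E x p z w = x p * L p := by
    intro p
    rw [hL, Finset.mul_sum]
    refine Finset.sum_congr rfl fun z _ => ?_
    rw [Finset.mul_sum]
    refine Finset.sum_congr rfl fun w _ => ?_
    rw [FI]; ring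
  have em : ∀ p r, ∑ z ∈ R, FF E x p r z = x p * x r * m p r := by
    intro p r
    rw [hm, Finset.mul_sum]
    refine Finset.sum_congr rfl fun z _ => ?_
    rw [FI]; ring
  rw [sumx, three_sum _ (FF_1 _ _) (FF_2 _ _) (FF_d E hE x) _ _ hb,
    three_sum _ (FF_1 _ _) (FF_2 _ _) (FF_d E hE x) _ _ hc,
    three_sum _ (FF_1 _ _) (FF_2 _ _) (FF_d E hE x) _ _ hd,
    t2 b _ c hc, t2 b _ d hd, t2 c _ d hd, RRR, Finset.sum_insert hd]
  rw [eL b, eL c, eL d, em b c, em b d, em c d]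
  have bcd : FF E x b c d ≤ x b * x c * x d := by
    rw [FI]; exact mul_le_of_le_one_right (by positivity) (I1 _ _ _)
  linarith

/-- For a dense `K_4^3 ∪ e`-free 3-graph `G` with `λ(G) > √3/18` and an optimum
weight vector `x`: if `G − {v}` is `K_4^3`-free then `x v > 0.0848`. -/
theorem weight_lower_bound (G : ThreeGraph) (hdense : G.LagDense) (hfree : G.Free K43e)
    (hlag : Real.sqrt 3 / 18 < G.lag) (x : ℕ → ℝ) (hx : G.IsOptimal x)
    (v : ℕ) (hv : v ∈ G.verts) (hdel : (G.deleteVert v).Free K43) :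
    0.0848 < x v := by
  have s2 : Real.sqrt 3 ^ 2 = 3 := Real.sq_sqrt (by norm_num)
  have s0 : 0 ≤ Real.sqrt 3 := Real.sqrt_nonneg 3
  have hpos : 0 < G.lag := lt_of_le_of_lt (by positivity) hlag
  by_contra hcon
  push Not at hcon
  have nk := no_K4_delete G v hdel
  -- some copy of `K_4^3` through `v` exists
  have ex : ∃ b c d : ℕ, ({v, b, c} : Finset ℕ) ∈ G.edges ∧ ({v, b, d} : Finset ℕ) ∈ G.edges ∧
      ({v, c, d} : Finset ℕ) ∈ G.edges ∧ ({b, c, d} : Finset ℕ) ∈ G.edges := by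
    by_contra hne
    have hb : 6 * G.lagFun x ≤ 0.577 := by
      refine case_free G x hx.1 fun a b c d h1 h2 h3 h4 => ?_
      by_cases ha : a = v
      · subst ha; exact hne ⟨b, c, d, h1, h2, h3, h4⟩
      by_cases hb : b = v
      · subst hb
        refine hne ⟨a, c, d, ?_, ?_, h4, h3⟩
        · rwa [Finset.insert_comm]
        · rwa [Finset.insert_comm]
      by_cases hc : c = v
      · subst hc
        refine hne ⟨a, b, d, ?_, ?_, ?_, h2⟩
        · rwa [Finset.insert_comm, Finset.pair_comm c b]
        · rwa [Finset.insert_comm]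
        · rwa [Finset.insert_comm]
      by_cases hd : d = v
      · subst hd
        refine hne ⟨a, b, c, ?_, ?_, ?_, h1⟩
        · rwa [Finset.insert_comm, Finset.pair_comm d b]
        · rwa [Finset.insert_comm, Finset.pair_comm d c]
        · rwa [Finset.insert_comm, Finset.pair_comm d c]
      exact nk a b c d ha hb hc hd h1 h2 h3 h4
    rw [hx.2] at hb
    have s1 : 1.7315 ≤ Real.sqrt 3 := by nlinarith
    norm_num at hb s1
    linarith
  obtain ⟨b, c, d, h1, h2, h3, h4⟩ := ex
  obtain ⟨nvb, nvc, nbc⟩ := edge_ne h1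
  obtain ⟨_, nvd, nbd⟩ := edge_ne h2
  obtain ⟨_, _, ncd⟩ := edge_ne h3
  obtain ⟨mb, mc, md⟩ := edge_mem h4
  obtain ⟨R, hR⟩ : ∃ R, R = (((G.verts.erase v).erase b).erase c).erase d := ⟨_, rfl⟩
  have hV : G.verts.erase v = insert b (insert c (insert d R)) := by
    rw [hR, Finset.insert_erase, Finset.insert_erase, Finset.insert_erase] <;>
      simp [mb, mc, md, nvb.symm, nvc.symm, nvd.symm, nbc.symm, nbd.symm, ncd.symm]
  have memR : ∀ z ∈ R, z ≠ v ∧ z ≠ b ∧ z ≠ c ∧ z ≠ d := by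
    intro z hz
    rw [hR] at hz
    simp only [Finset.mem_erase] at hz
    tauto
  have bound := case_K4 G.edges G.card_eq x R b c d
    (by rw [hR]; simp [nbc, nbd]) (by rw [hR]; simp [ncd]) (by rw [hR]; simp)
    (fun z hz => hx.1.1 z (Finset.mem_of_mem_erase (hV ▸ hz)))
    (fun z hz w hw u hu h => K4_meets G hfree v b c d z w u h1 h2 h3 h4
      (memR z hz) (memR w hw) (memR u hu) h)
    (fun i hi j hj z hz w hw e1 e2 e3 e4 => nk i j z w
      (Finset.ne_of_mem_erase (hV ▸ hi)) (Finset.ne_of_mem_erase (hV ▸ hj))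
      (memR z hz).1 (memR w hw).1 e1 e2 e3 e4)
  rw [← hV] at bound
  have hs : ∑ i ∈ G.verts.erase v, x i = 1 - x v := by
    have := Finset.add_sum_erase G.verts x hv
    rw [hx.1.2] at this
    linarith
  rw [hs] at bound
  have hk := kkt G hpos x hx v hv
  refine final_real (Real.sqrt 3) (6 * G.lagFun x) _ (x v) s2 s0 ?_ (hx.1.1 v hv) hcon hk bound
  rw [hx.2]; linarith
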